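/- arXiv:2112.00955 — 2 statements merged into one kernel-verified Lean document; each statement's English description precedes it below -/
import Mathlib

section
/- Let P and N be finite nonempty sets (the positive and negative samples) and let s be a score function assigning a real number to each element of P ∪ N. Let r_p, r_n ∈ [0,1]. If the number of positives p ∈ P with s(p) > 1/2 is at least r_p·|P| and the number of negatives n ∈ N with s(n) < 1/2 is at least r_n·|N|, then AUC(s) ≥ r_p·r_n. -/
open Finset

/-- AUC of a score function `s` w.r.t. positive set `P` and negative set `N`:
the average over pairs `(p, n) ∈ P × N` of `1` if `s p > s n`, `1/2` if
`s p = s n`, and `0` if `s p < s n`. -/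
noncomputable def AUC {α : Type*} (P N : Finset α) (s : α → ℝ) : ℝ :=
  (1 / ((P.card : ℝ) * (N.card : ℝ))) *
    ∑ p ∈ P, ∑ n ∈ N,
      (if s p > s n then (1 : ℝ) else if s p = s n then 1 / 2 else 0)

theorem auc_lower_bound_product {α : Type*} [DecidableEq α]
    (P N : Finset α) (hP : P.Nonempty) (hN : N.Nonempty)
    (s : α → ℝ) (r_p r_n : ℝ)
    (hrp0 : 0 ≤ r_p) (hrp1 : r_p ≤ 1) (hrn0 : 0 ≤ r_n) (hrn1 : r_n ≤ 1)
    (hpos : r_p * P.card ≤ ((P.filter (fun p => s p > 1 / 2)).card : ℝ))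
    (hneg : r_n * N.card ≤ ((N.filter (fun n => s n < 1 / 2)).card : ℝ)) :
    r_p * r_n ≤ AUC P N s := by
  have hPc : (0 : ℝ) < P.card := by exact_mod_cast hP.card_pos
  have hNc : (0 : ℝ) < N.card := by exact_mod_cast hN.card_pos
  have pairs_le : ((P.filter (fun p => s p > 1 / 2)).card : ℝ) *
      ((N.filter (fun n => s n < 1 / 2)).card : ℝ) ≤
      ∑ p ∈ P, ∑ n ∈ N,
        (if s p > s n then (1 : ℝ) else if s p = s n then 1 / 2 else 0) := by
    rw [Finset.natCast_card_filter, Finset.natCast_card_filter, Finset.sum_mul_sum]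
    refine Finset.sum_le_sum fun p _ => Finset.sum_le_sum fun n _ => ?_
    split_ifs <;> linarith
  unfold AUC
  rw [one_div_mul_eq_div, le_div_iff₀ (mul_pos hPc hNc)]
  calc r_p * r_n * (P.card * N.card) = (r_p * P.card) * (r_n * N.card) := by ring
    _ ≤ _ := mul_le_mul hpos hneg (by positivity) (by positivity)
    _ ≤ _ := pairs_le
end

section
/- Let k ≥ 1 and let p : Fin k → ℝ satisfy p(i) > 0 for all i and Σ_i p(i) = 1. Set L̄ = (1/k)·Σ_j log p(j), let v(i) = log p(i) − L̄, and let H(q) = −Σ_i q(i) log q(i). Then the function t ↦ H(p + t·v) is differentiable at t = 0 with derivative equal to −Σ_i (log p(i) − L̄)²; consequently this derivative is ≤ 0, and it equals 0 if and only if p(i) = 1/k for all i. -/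
open Finset Real

/-- The directional derivative of `q ↦ -∑ i, q i * log (q i)` at a point with nonzero
coordinates. -/
theorem hasDerivAt_neg_sum_mul_log_line {ι : Type*} [Fintype ι] (p v : ι → ℝ)
    (hp : ∀ i, p i ≠ 0) :
    HasDerivAt (fun t : ℝ => -∑ i, (p i + t * v i) * Real.log (p i + t * v i))
      (-∑ i, (Real.log (p i) + 1) * v i) 0 := by
  refine (HasDerivAt.fun_sum fun i _ => ?_).fun_neg
  have hline : HasDerivAt (fun t : ℝ => p i + t * v i) (v i) 0 := by
    simpa using ((hasDerivAt_id (0 : ℝ)).mul_const (v i)).const_add (p i)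
  have hlog : HasDerivAt (fun x : ℝ => x * Real.log x) (Real.log (p i) + 1)
      (p i + 0 * v i) := by
    simpa using Real.hasDerivAt_mul_log (hp i)
  exact hlog.comp 0 hline

theorem entropy_derivative_along_projected_descent (k : ℕ) (hk : 1 ≤ k)
    (p : Fin k → ℝ) (hp : ∀ i, 0 < p i) (hsum : ∑ i, p i = 1)
    (L : ℝ) (hL : L = (1 / (k : ℝ)) * ∑ j, Real.log (p j))
    (v : Fin k → ℝ) (hv : ∀ i, v i = Real.log (p i) - L)
    (H : (Fin k → ℝ) → ℝ) (hH : ∀ q, H q = -∑ i, q i * Real.log (q i)) :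
    HasDerivAt (fun t : ℝ => H (fun i => p i + t * v i))
      (-∑ i, (Real.log (p i) - L) ^ 2) 0 ∧
    (-∑ i, (Real.log (p i) - L) ^ 2) ≤ 0 ∧
    ((-∑ i, (Real.log (p i) - L) ^ 2) = 0 ↔ ∀ i, p i = 1 / (k : ℝ)) := by
  have hk0 : (k : ℝ) ≠ 0 := by positivity
  have hlog_sum : ∑ j, Real.log (p j) = k * L := by rw [hL]; field_simp
  have hv_sum : ∑ i, v i = 0 := by simp [hv, hlog_sum]
  refine ⟨?_, neg_nonpos.mpr (sum_nonneg fun i _ => sq_nonneg _), ?_⟩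
  · have hderiv : ∑ i, (Real.log (p i) - L) ^ 2 = ∑ i, (Real.log (p i) + 1) * v i := by
      have hterm : ∀ i, (Real.log (p i) + 1) * v i =
          (Real.log (p i) - L) ^ 2 + (L + 1) * v i := fun i => by rw [hv]; ring
      simp only [hterm, sum_add_distrib, ← mul_sum, hv_sum, mul_zero, add_zero]
    simp only [hH, hderiv]
    exact hasDerivAt_neg_sum_mul_log_line p v fun i => (hp i).ne'
  · rw [neg_eq_zero, sum_eq_zero_iff_of_nonneg fun i _ => sq_nonneg _]
    simp only [mem_univ, true_imp_iff, sq_eq_zero_iff, sub_eq_zero]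
    constructor
    · intro h i
      have hconst : ∀ j, p j = p i := fun j =>
        Real.log_injOn_pos (hp j) (hp i) ((h j).trans (h i).symm)
      rw [eq_div_iff hk0, mul_comm]
      simpa [hconst] using hsum
    · intro h i
      rw [hL]
      simp only [h, sum_const, card_univ, Fintype.card_fin, nsmul_eq_mul]
      field_simp
end
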